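/- For i ≥ 1 let e_i: ℂ[[r]] → ℂ[[r]] be the ℂ-linear operator e_i(f) = r^{i+1}·(Df). Then [e_i, e_j] = (j−i)·e_{i+j} for all i,j ≥ 1, and the ℂ-linear map from the span of {D∘L^{i−1} : i ≥ 1} (operators on ℂ[[z]]) to the span of {e_i : i ≥ 1} determined by D∘L^{i−1} ↦ −e_i is a well-defined Lie algebra isomorphism, where in both algebras [f,g]=f∘g−g∘f. -/

import Mathlib

noncomputable section

/-- The formal differentiation operator `D` on `ℂ[[z]]`: `(Df)(z) = ∑ (k+1) c_{k+1} z^k`. -/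
def Dop : Module.End ℂ (PowerSeries ℂ) where
  toFun f := PowerSeries.mk fun k => ((k : ℂ) + 1) * PowerSeries.coeff (k + 1) f
  map_add' f g := by
    ext k
    simp [mul_add]
  map_smul' c f := by
    ext k
    simp
    ring

/-- The left translation operator `L` on `ℂ[[z]]`: `(Lf)(z) = ∑ c_{k+1} z^k`. -/
def Lop : Module.End ℂ (PowerSeries ℂ) where
  toFun f := PowerSeries.mk fun k => PowerSeries.coeff (k + 1) f
  map_add' f g := by ext k; simp
  map_smul' c f := by ext k; simp

/-- The operator `e_i` on `ℂ[[r]]`: `e_i(f) = r^{i+1}·(Df)`. -/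
def Eop (i : ℕ) : Module.End ℂ (PowerSeries ℂ) :=
  LinearMap.mulLeft ℂ ((PowerSeries.X : PowerSeries ℂ) ^ (i + 1)) ∘ₗ Dop

/-- The set `{D∘L^{i−1} : i ≥ 1}`. -/
def DLset : Set (Module.End ℂ (PowerSeries ℂ)) :=
  {f | ∃ i : ℕ, 1 ≤ i ∧ f = Dop * Lop ^ (i - 1)}

/-- The set `{e_i : i ≥ 1}`. -/
def Eset : Set (Module.End ℂ (PowerSeries ℂ)) :=
  {f | ∃ i : ℕ, 1 ≤ i ∧ f = Eop i}

/-- The Lie bracket of the positive part of the Witt algebra, written on coefficient vectors: on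
basis vectors it is `[v i, v j] = (i - j) • v (i + j + 1)`. -/
def wittBracket (a b : ℕ →₀ ℂ) : ℕ →₀ ℂ :=
  a.sum fun i r => b.sum fun j s => Finsupp.single (i + j + 1) (r * s * ((i : ℂ) - j))

section Witt

variable {M : Type*} [AddCommGroup M] [Module ℂ M] {v : ℕ → Module.End ℂ M}

theorem lie_linearCombination_eq (hv : ∀ i j, ⁅v i, v j⁆ = ((i : ℂ) - j) • v (i + j + 1))
    (a b : ℕ →₀ ℂ) :
    ⁅Finsupp.linearCombination ℂ v a, Finsupp.linearCombination ℂ v b⁆ =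
      Finsupp.linearCombination ℂ v (wittBracket a b) := by
  simp only [wittBracket, map_finsuppSum, Finsupp.linearCombination_single]
  simp only [Ring.lie_def] at hv
  simp only [Ring.lie_def, Finsupp.linearCombination_apply, Finsupp.sum, Finset.sum_mul_sum,
    smul_mul_smul_comm]
  rw [Finset.sum_comm (s := b.support), ← Finset.sum_sub_distrib]
  refine Finset.sum_congr rfl fun i _ => ?_
  rw [← Finset.sum_sub_distrib]
  refine Finset.sum_congr rfl fun j _ => ?_
  rw [mul_comm (b j), ← smul_sub, hv, smul_smul]

theorem lie_mem_span_range (hv : ∀ i j, ⁅v i, v j⁆ = ((i : ℂ) - j) • v (i + j + 1))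
    {x y : Module.End ℂ M}
    (hx : x ∈ Submodule.span ℂ (Set.range v)) (hy : y ∈ Submodule.span ℂ (Set.range v)) :
    ⁅x, y⁆ ∈ Submodule.span ℂ (Set.range v) := by
  rw [Finsupp.mem_span_range_iff_exists_finsupp] at hx hy
  obtain ⟨a, rfl⟩ := hx
  obtain ⟨b, rfl⟩ := hy
  simp only [← Finsupp.linearCombination_apply, lie_linearCombination_eq hv]
  exact Finsupp.mem_span_range_iff_exists_finsupp.mpr ⟨_, rfl⟩

/-- Linearly independent families of endomorphisms with the same Witt structure constants span
isomorphic Lie algebras. -/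
theorem exists_linearEquiv_span_range_lie {N : Type*} [AddCommGroup N] [Module ℂ N]
    {u : ℕ → Module.End ℂ N}
    (hv : ∀ i j, ⁅v i, v j⁆ = ((i : ℂ) - j) • v (i + j + 1))
    (hu : ∀ i j, ⁅u i, u j⁆ = ((i : ℂ) - j) • u (i + j + 1))
    (hvi : LinearIndependent ℂ v) (hui : LinearIndependent ℂ u) :
    ∃ w : Submodule.span ℂ (Set.range v) ≃ₗ[ℂ] Submodule.span ℂ (Set.range u),
      (∀ i h, (w ⟨v i, h⟩ : Module.End ℂ N) = u i) ∧
      ∀ (x y : Submodule.span ℂ (Set.range v))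
        (h : ⁅(x : Module.End ℂ M), (y : Module.End ℂ M)⁆ ∈ _),
        (w ⟨⁅(x : Module.End ℂ M), (y : Module.End ℂ M)⁆, h⟩ : Module.End ℂ N) =
          ⁅(w x : Module.End ℂ N), (w y : Module.End ℂ N)⁆ := by
  let w := hvi.linearCombinationEquiv.symm.trans hui.linearCombinationEquiv
  have hw : ∀ (a : ℕ →₀ ℂ) (x : Submodule.span ℂ (Set.range v)),
      Finsupp.linearCombination ℂ v a = x →
        (w x : Module.End ℂ N) = Finsupp.linearCombination ℂ u a := by
    intro a x hx
    obtain rfl : hvi.linearCombinationEquiv a = x := Subtype.ext hx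
    simp [w]
  refine ⟨w, fun i h => ?_, fun x y h => ?_⟩
  · rw [hw (Finsupp.single i 1) _ (by simp)]
    simp
  · have hx := hvi.linearCombination_repr x
    have hy := hvi.linearCombination_repr y
    rw [hw _ x hx, hw _ y hy, lie_linearCombination_eq hu]
    exact hw _ _ (by rw [← lie_linearCombination_eq hv, hx, hy])

end Witt

theorem Dop_apply (f : PowerSeries ℂ) : Dop f = PowerSeries.derivative ℂ f := by
  ext k
  simp [Dop, PowerSeries.coeff_derivative, mul_comm]

theorem Eop_apply (i : ℕ) (f : PowerSeries ℂ) :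
    Eop i f = PowerSeries.X ^ (i + 1) * PowerSeries.derivative ℂ f := by
  simp [Eop, Dop_apply]

theorem lie_Eop (i j : ℕ) : ⁅Eop i, Eop j⁆ = ((j : ℂ) - (i : ℂ)) • Eop (i + j) := by
  refine LinearMap.ext fun f => ?_
  simp only [Ring.lie_def, LinearMap.sub_apply, Module.End.mul_apply, LinearMap.smul_apply,
    Eop_apply, Derivation.leibniz, Derivation.leibniz_pow, PowerSeries.derivative_X, smul_eq_mul,
    PowerSeries.smul_eq_C_mul, nsmul_eq_mul, map_sub, map_natCast, Nat.cast_add, Nat.cast_one,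
    Nat.add_sub_cancel]
  ring

theorem coeff_Lop_pow (n k : ℕ) (f : PowerSeries ℂ) :
    PowerSeries.coeff k ((Lop ^ n) f) = PowerSeries.coeff (k + n) f := by
  induction n generalizing f with
  | zero => simp
  | succ n ih => rw [pow_succ, Module.End.mul_apply, ih]; simp [Lop, add_assoc]

theorem coeff_Dop_mul_Lop_pow (n k : ℕ) (f : PowerSeries ℂ) :
    PowerSeries.coeff k ((Dop * Lop ^ n) f) =
      ((k : ℂ) + 1) * PowerSeries.coeff (k + n + 1) f := by
  simp [Dop, coeff_Lop_pow, add_right_comm]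

theorem lie_Dop_mul_Lop_pow (i j : ℕ) :
    ⁅Dop * Lop ^ i, Dop * Lop ^ j⁆ = ((i : ℂ) - j) • (Dop * Lop ^ (i + j + 1)) := by
  refine LinearMap.ext fun f => PowerSeries.ext fun k => ?_
  rw [Ring.lie_def, LinearMap.sub_apply, Module.End.mul_apply (Dop * Lop ^ i),
    Module.End.mul_apply (Dop * Lop ^ j), LinearMap.smul_apply, map_sub, map_smul]
  simp only [coeff_Dop_mul_Lop_pow, smul_eq_mul]
  rw [show k + i + 1 + j + 1 = k + (i + j + 1) + 1 by ring,
    show k + j + 1 + i + 1 = k + (i + j + 1) + 1 by ring]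
  push_cast
  ring

theorem lie_neg_Eop (i j : ℕ) :
    ⁅-Eop (i + 1), -Eop (j + 1)⁆ = ((i : ℂ) - j) • -Eop (i + j + 1 + 1) := by
  have h : ⁅-Eop (i + 1), -Eop (j + 1)⁆ = ⁅Eop (i + 1), Eop (j + 1)⁆ :=
    congrArg₂ (· - ·) (neg_mul_neg _ _) (neg_mul_neg _ _)
  rw [h, lie_Eop, smul_neg, ← neg_smul,
    show i + 1 + (j + 1) = i + j + 1 + 1 by ring]
  push_cast
  congr 1
  ring

theorem linearIndependent_Dop_mul_Lop_pow :
    LinearIndependent ℂ fun i : ℕ => Dop * Lop ^ i := by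
  refine .of_pairwise_dual_eq_zero_one _
    (fun m => PowerSeries.coeff 0 ∘ₗ LinearMap.applyₗ (PowerSeries.X ^ (m + 1)))
    (fun m i hmi => ?_) fun m => ?_
  all_goals
    simp only [LinearMap.comp_apply, LinearMap.applyₗ_apply_apply, coeff_Dop_mul_Lop_pow]
    simp [PowerSeries.coeff_X_pow, *]
  exact hmi.symm

theorem linearIndependent_neg_Eop : LinearIndependent ℂ fun i : ℕ => -Eop (i + 1) := by
  refine .of_pairwise_dual_eq_zero_one _
    (fun m => -(PowerSeries.coeff (m + 2) ∘ₗ LinearMap.applyₗ PowerSeries.X))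
    (fun m i hmi => ?_) fun m => ?_
  all_goals simp [Eop_apply, PowerSeries.coeff_X_pow, *]

theorem DLset_eq_range : DLset = Set.range fun i : ℕ => Dop * Lop ^ i := by
  ext f
  constructor
  · rintro ⟨i, -, rfl⟩
    exact ⟨i - 1, rfl⟩
  · rintro ⟨i, rfl⟩
    exact ⟨i + 1, by simp, by simp⟩

theorem Eset_eq_neg_range : Eset = -Set.range fun i : ℕ => -Eop (i + 1) := by
  ext f
  constructor
  · rintro ⟨i, hi, rfl⟩
    exact ⟨i - 1, by simp [Nat.sub_add_cancel hi]⟩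
  · rintro ⟨i, hi⟩
    exact ⟨i + 1, by simp, (neg_injective hi).symm⟩

theorem span_Eset :
    Submodule.span ℂ Eset = Submodule.span ℂ (Set.range fun i : ℕ => -Eop (i + 1)) := by
  rw [Eset_eq_neg_range, Submodule.span_neg]

/-- `[e_i, e_j] = (j−i)·e_{i+j}` for `i, j ≥ 1`, and the `ℂ`-linear map
from `span{D∘L^{i−1} : i ≥ 1}` to `span{e_i : i ≥ 1}` determined by `D∘L^{i−1} ↦ −e_i`
is a well-defined Lie algebra isomorphism (both spans are closed under the commutator
bracket, and the map is a linear equivalence intertwining the brackets). -/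
theorem witt_isomorphism :
    (∀ i j : ℕ, 1 ≤ i → 1 ≤ j →
        ⁅Eop i, Eop j⁆ = ((j : ℂ) - (i : ℂ)) • Eop (i + j)) ∧
    (∀ x ∈ Submodule.span ℂ DLset, ∀ y ∈ Submodule.span ℂ DLset,
        ⁅x, y⁆ ∈ Submodule.span ℂ DLset) ∧
    (∀ x ∈ Submodule.span ℂ Eset, ∀ y ∈ Submodule.span ℂ Eset,
        ⁅x, y⁆ ∈ Submodule.span ℂ Eset) ∧
    ∃ w : Submodule.span ℂ DLset ≃ₗ[ℂ] Submodule.span ℂ Eset,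
      (∀ (i : ℕ), 1 ≤ i → ∀ (h : Dop * Lop ^ (i - 1) ∈ Submodule.span ℂ DLset),
        ((w ⟨Dop * Lop ^ (i - 1), h⟩ : Submodule.span ℂ Eset) :
          Module.End ℂ (PowerSeries ℂ)) = -(Eop i)) ∧
      (∀ (x y : Submodule.span ℂ DLset)
        (h : ⁅(x : Module.End ℂ (PowerSeries ℂ)), (y : Module.End ℂ (PowerSeries ℂ))⁆ ∈
          Submodule.span ℂ DLset),
        ((w ⟨⁅(x : Module.End ℂ (PowerSeries ℂ)), (y : Module.End ℂ (PowerSeries ℂ))⁆, h⟩ :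
            Submodule.span ℂ Eset) : Module.End ℂ (PowerSeries ℂ)) =
          ⁅((w x : Submodule.span ℂ Eset) : Module.End ℂ (PowerSeries ℂ)),
            ((w y : Submodule.span ℂ Eset) : Module.End ℂ (PowerSeries ℂ))⁆) := by
  rw [DLset_eq_range, span_Eset]
  obtain ⟨w, hw, hlie⟩ := exists_linearEquiv_span_range_lie lie_Dop_mul_Lop_pow lie_neg_Eop
    linearIndependent_Dop_mul_Lop_pow linearIndependent_neg_Eop
  refine ⟨fun i j _ _ => lie_Eop i j, fun x hx y hy => lie_mem_span_range lie_Dop_mul_Lop_pow hx hy,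
    fun x hx y hy => lie_mem_span_range lie_neg_Eop hx hy, w, fun i hi h => ?_, hlie⟩
  rw [hw (i - 1) h, Nat.sub_add_cancel hi]
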